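/- Let Σ̄ be a d×d correlation matrix (symmetric positive definite with unit diagonal), let X be a random vector with density φ_d(·; Σ̄), let X′ be a standard normal random variable independent of X, let ε ∈ ℝ, and let X″ be a random variable independent of X with the law of X′ conditioned on X′ + ε > 0 (density φ(t) 1_{t > −ε} / Φ(ε)). Given δ ∈ (−1,1)^d, define Z ∈ ℝ^d by Z_i = √(1 − δ_i²) X_i + δ_i X″. Then for all i, j ∈ {1,…,d}: E[Z_i] = δ_i φ(ε)/Φ(ε), and Cov(Z_i, Z_j) = Σ̄_{ij} √( (1 − δ_i²)(1 − δ_j²) ) + δ_i δ_j (1 − r), where r = (φ(ε)/Φ(ε)) ( ε + φ(ε)/Φ(ε) ); in particular Var(Z_i) = 1 − δ_i² r. -/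

import Mathlib

open MeasureTheory Real Filter Matrix Set Topology Asymptotics

noncomputable section

/-- Standard normal density. -/
def nPdf (x : ℝ) : ℝ := (Real.sqrt (2 * π))⁻¹ * Real.exp (-(x ^ 2) / 2)

/-- Standard normal distribution function. -/
def nCdf (x : ℝ) : ℝ := ∫ u in Set.Iio x, nPdf u

/-- Centred multivariate normal density with covariance matrix `S`. -/
def mvnPdf {ι : Type*} [Fintype ι] [DecidableEq ι] (S : Matrix ι ι ℝ) (y : ι → ℝ) : ℝ :=
  (2 * π) ^ (-(Fintype.card ι : ℝ) / 2) * S.det ^ (-(1 : ℝ) / 2) *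
    Real.exp (-(y ⬝ᵥ S⁻¹.mulVec y) / 2)

/-- Centred multivariate normal distribution function. -/
def mvnCdf {ι : Type*} [Fintype ι] [DecidableEq ι] (S : Matrix ι ι ℝ) (w : ι → ℝ) : ℝ :=
  ∫ u in Set.univ.pi fun i => Set.Iic (w i), mvnPdf S u

/-- Multivariate central Student-t density with scale matrix `S` and `ν` degrees of freedom. -/
def tPdf {ι : Type*} [Fintype ι] [DecidableEq ι] (S : Matrix ι ι ℝ) (ν : ℝ) (y : ι → ℝ) : ℝ :=
  Real.Gamma ((ν + Fintype.card ι) / 2) *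
      (1 + y ⬝ᵥ S⁻¹.mulVec y / ν) ^ (-(ν + Fintype.card ι) / 2) /
    (Real.Gamma (ν / 2) * (ν * π) ^ ((Fintype.card ι : ℝ) / 2) * Real.sqrt S.det)

/-- Univariate non-central t distribution function with non-centrality `a`. -/
def nctCdf (x a ν : ℝ) : ℝ :=
  ∫ v in Set.Ioi (0 : ℝ),
    v ^ (ν / 2 - 1) * Real.exp (-v) / Real.Gamma (ν / 2) *
      nCdf (x * Real.sqrt (2 * v / ν) - a)

/-- Multivariate non-central t distribution function. -/
def mvnctCdf {ι : Type*} [Fintype ι] [DecidableEq ι]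
    (y : ι → ℝ) (S : Matrix ι ι ℝ) (κ : ι → ℝ) (ν : ℝ) : ℝ :=
  ∫ v in Set.Ioi (0 : ℝ),
    v ^ (ν / 2 - 1) * Real.exp (-v) / Real.Gamma (ν / 2) *
      mvnCdf S fun i => y i * Real.sqrt (2 * v / ν) - κ i

/-- Multivariate non-central t density (scale-mixture form). -/
def mvnctPdf {ι : Type*} [Fintype ι] [DecidableEq ι]
    (μ : ι → ℝ) (S : Matrix ι ι ℝ) (κ : ι → ℝ) (ν : ℝ) (y : ι → ℝ) : ℝ :=
  ∫ v in Set.Ioi (0 : ℝ),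
    v ^ (ν / 2 - 1) * Real.exp (-v) / Real.Gamma (ν / 2) *
      ((2 * v / ν) ^ ((Fintype.card ι : ℝ) / 2) *
        mvnPdf S fun i => Real.sqrt (2 * v / ν) * (y i - μ i) - κ i)

/-- Univariate non-central t density with location `μ`, scale (standard deviation) `s`,
non-centrality `κ` and `ν` degrees of freedom. -/
def nctPdf1 (μ s κ ν x : ℝ) : ℝ :=
  ∫ v in Set.Ioi (0 : ℝ),
    v ^ (ν / 2 - 1) * Real.exp (-v) / Real.Gamma (ν / 2) *
      (Real.sqrt (2 * v / ν) * s⁻¹ * nPdf (Real.sqrt (2 * v / ν) * (x - μ) / s - κ))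

/-- Non-central extended skew-t density. -/
def skewTPdf {ι : Type*} [Fintype ι] [DecidableEq ι]
    (μ : ι → ℝ) (Ω : Matrix ι ι ℝ) (α : ι → ℝ) (τ κ ν : ℝ) (y : ι → ℝ) : ℝ :=
  let d : ℝ := Fintype.card ι
  let ω : Matrix ι ι ℝ := Matrix.diagonal fun i => Real.sqrt (Ω i i)
  let Ωb : Matrix ι ι ℝ := ω⁻¹ * Ω * ω⁻¹
  let z : ι → ℝ := ω⁻¹.mulVec fun i => y i - μ i
  let Q : ℝ := α ⬝ᵥ Ωb.mulVec α
  tPdf Ω ν (fun i => y i - μ i) *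
      nctCdf ((α ⬝ᵥ z + τ) * Real.sqrt ((ν + d) / (ν + z ⬝ᵥ Ωb⁻¹.mulVec z))) κ (ν + d) /
    nctCdf (τ / Real.sqrt (1 + Q)) (κ / Real.sqrt (1 + Q)) ν

/-- Non-central extended skew-t distribution function. -/
def skewTCdf {ι : Type*} [Fintype ι] [DecidableEq ι]
    (μ : ι → ℝ) (Ω : Matrix ι ι ℝ) (α : ι → ℝ) (τ κ ν : ℝ) (y : ι → ℝ) : ℝ :=
  ∫ u in Set.univ.pi fun i => Set.Iic (y i), skewTPdf μ Ω α τ κ ν u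



open ProbabilityTheory in
lemma nPdf_eq_gauss (x : ℝ) : nPdf x = gaussianPDFReal 0 1 x := by
  simp [nPdf, gaussianPDFReal]

open ProbabilityTheory in
lemma pi_gauss (d : ℕ) :
    (volume : Measure (Fin d → ℝ)).withDensity (fun x => ENNReal.ofReal (∏ i, nPdf (x i)))
      = Measure.pi (fun _ => gaussianReal 0 1) := by
  symm
  refine Measure.pi_eq fun s hs => ?_
  simp_rw [nPdf_eq_gauss]
  rw [withDensity_apply _ (MeasurableSet.univ_pi hs), volume_pi, Measure.restrict_pi_pi,
    ← ofReal_integral_eq_lintegral_ofReal]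
  · rw [integral_fintype_prod_eq_prod (fun _ => gaussianPDFReal 0 1), ENNReal.ofReal_prod_of_nonneg]
    · refine Finset.prod_congr rfl fun i _ => ?_
      rw [gaussianReal_apply_eq_integral _ (by simp)]
    · intro i _
      exact integral_nonneg fun x => gaussianPDFReal_nonneg _ _ _
  · exact Integrable.fintype_prod (f := fun _ => gaussianPDFReal 0 1) (fun i => (integrable_gaussianPDFReal 0 1).integrableOn)
  · exact Eventually.of_forall fun x => Finset.prod_nonneg fun i _ => gaussianPDFReal_nonneg _ _ _

lemma exists_root {d : ℕ} {S : Matrix (Fin d) (Fin d) ℝ} (h : S.PosDef) :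
    ∃ A : Matrix (Fin d) (Fin d) ℝ, S = A * Aᵀ ∧ A.det ≠ 0 := by
  obtain ⟨B, hB⟩ : ∃ B : Matrix (Fin d) (Fin d) ℝ, S = Bᴴ * B := by
    open scoped MatrixOrder Matrix.Norms.L2Operator in
    exact CStarAlgebra.nonneg_iff_eq_star_mul_self.mp h.posSemidef.nonneg
  refine ⟨Bᵀ, by simpa using hB, ?_⟩
  have := h.det_pos
  rw [hB] at this
  intro h0
  simp at h0
  simp [h0] at this

lemma mvnPdf_nonneg {d : ℕ} {S : Matrix (Fin d) (Fin d) ℝ} (h : S.PosDef) (y : Fin d → ℝ) :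
    0 ≤ mvnPdf S y := by
  have := h.det_pos
  unfold mvnPdf; positivity

lemma mvnPdf_cont {d : ℕ} (S : Matrix (Fin d) (Fin d) ℝ) : Continuous (mvnPdf S) := by
  unfold mvnPdf
  have : Continuous fun y : Fin d → ℝ => S⁻¹ *ᵥ y := Continuous.matrix_mulVec continuous_const continuous_id
  have : Continuous fun y : Fin d → ℝ => y ⬝ᵥ S⁻¹ *ᵥ y := Continuous.dotProduct continuous_id this
  fun_prop

lemma mvnPdf_comp {d : ℕ} {A : Matrix (Fin d) (Fin d) ℝ} (hA : A.det ≠ 0) (x : Fin d → ℝ) :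
    mvnPdf (A * Aᵀ) (A *ᵥ x) * |A.det| = ∏ i, nPdf (x i) := by
  have hU : IsUnit A.det := hA.isUnit
  have h1 : (A *ᵥ x) ⬝ᵥ (A * Aᵀ)⁻¹ *ᵥ (A *ᵥ x) = ∑ i, x i ^ 2 := by
    have : (A *ᵥ x) ⬝ᵥ (A * Aᵀ)⁻¹ *ᵥ (A *ᵥ x) = x ⬝ᵥ x := by
      rw [Matrix.mul_inv_rev, ← Matrix.mulVec_mulVec, Matrix.mulVec_mulVec _ A⁻¹ A,
        Matrix.nonsing_inv_mul _ hU, Matrix.one_mulVec, Matrix.dotProduct_mulVec,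
        ← Matrix.mulVec_transpose, ← Matrix.transpose_nonsing_inv, Matrix.transpose_transpose, Matrix.mulVec_mulVec,
        Matrix.nonsing_inv_mul _ hU, Matrix.one_mulVec]
    rw [this]; simp [dotProduct, pow_two]
  have h2 : (A * Aᵀ).det ^ (-(1:ℝ)/2) * |A.det| = 1 := by
    rw [Matrix.det_mul, Matrix.det_transpose, ← abs_mul_abs_self, ← pow_two, ← Real.rpow_natCast,
      ← Real.rpow_mul (abs_nonneg _)]
    norm_num
    rw [Real.rpow_neg_one]
    exact inv_mul_cancel₀ (by simpa using hA)
  have h3 : (2 * π : ℝ) ^ (-(d:ℝ)/2) = ((Real.sqrt (2*π))⁻¹)^d := by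
    rw [Real.sqrt_eq_rpow, ← Real.rpow_neg (by positivity), ← Real.rpow_natCast, ← Real.rpow_mul (by positivity)]
    congr 1; ring
  unfold mvnPdf nPdf
  rw [h1, Finset.prod_mul_distrib, ← Real.exp_sum, Fintype.card_fin, h3]
  simp only [Finset.prod_const, Finset.card_univ, Fintype.card_fin]
  rw [← Finset.sum_div, Finset.sum_neg_distrib]
  linear_combination (((Real.sqrt (2*π))⁻¹)^d * rexp (-(∑ i, x i ^ 2) / 2)) * h2

open ProbabilityTheory in
lemma mvn_law {d : ℕ} {A : Matrix (Fin d) (Fin d) ℝ} (hA : A.det ≠ 0) :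
    (volume : Measure (Fin d → ℝ)).withDensity (fun x => ENNReal.ofReal (mvnPdf (A * Aᵀ) x))
      = (Measure.pi (fun _ => gaussianReal 0 1)).map (fun x => A *ᵥ x) := by
  have hm : Measurable (fun x : Fin d → ℝ => A *ᵥ x) :=
    (Continuous.matrix_mulVec continuous_const continuous_id).measurable
  have hc := (mvnPdf_cont (A * Aᵀ)).measurable
  have hv := Real.map_matrix_volume_pi_eq_smul_volume_pi hA
  have hv2 : (volume : Measure (Fin d → ℝ)) = ENNReal.ofReal |A.det| •
      (volume : Measure (Fin d → ℝ)).map (fun x => A *ᵥ x) := by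
    have : (fun x => A *ᵥ x) = ⇑(toLin' A) := by ext; simp
    rw [this, hv, smul_smul, ← ENNReal.ofReal_mul (abs_nonneg _), ← abs_mul, mul_inv_cancel₀ hA]
    simp
  rw [← pi_gauss]
  ext s hs
  rw [Measure.map_apply hm hs, withDensity_apply _ hs, withDensity_apply _ (hm hs)]
  conv_lhs => rw [hv2]
  rw [Measure.restrict_smul, lintegral_smul_measure, setLIntegral_map hs (by fun_prop) hm, smul_eq_mul,
    ← lintegral_const_mul _ (by fun_prop)]
  refine lintegral_congr fun x => ?_
  rw [← mvnPdf_comp hA, mul_comm, ENNReal.ofReal_mul' (abs_nonneg _)]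

open ProbabilityTheory in
lemma gauss_coord {d : ℕ} (k l : Fin d) :
    ∫ x, x k * x l ∂(Measure.pi (fun _ : Fin d => gaussianReal 0 1)) = if k = l then 1 else 0 := by
  split_ifs with h
  · subst h
    rw [integral_comp_eval (μ := fun _ : Fin d => gaussianReal 0 1) (i := k) (f := fun t : ℝ => t * t)
      (by fun_prop)]
    have h1 := variance_eq_sub (memLp_id_gaussianReal (μ := 0) (v := 1) 2)
    simp [pow_two] at h1
    linarith
  · have hi := (iIndepFun_pi (μ := fun _ : Fin d => gaussianReal 0 1) (X := fun _ (t : ℝ) => t)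
      (fun i => aemeasurable_id)).indepFun h
    rw [hi.integral_fun_mul_eq_mul_integral (measurable_pi_apply k).aestronglyMeasurable
      (measurable_pi_apply l).aestronglyMeasurable]
    rw [integral_comp_eval (μ := fun _ : Fin d => gaussianReal 0 1) (i := k) (f := fun t : ℝ => t)
      (by fun_prop)]
    simp

open ProbabilityTheory in
lemma gauss_memLp {d : ℕ} (k : Fin d) :
    MemLp (fun x : Fin d → ℝ => x k) 2 (Measure.pi (fun _ : Fin d => gaussianReal 0 1)) :=
  (memLp_id_gaussianReal (μ := 0) (v := 1) 2).comp_measurePreserving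
    (measurePreserving_eval (fun _ : Fin d => gaussianReal 0 1) k)

open ProbabilityTheory in
lemma mvn_moments {d : ℕ} {S : Matrix (Fin d) (Fin d) ℝ} (hS : S.PosDef) (ν : Measure (Fin d → ℝ))
    (hν : ν = volume.withDensity (fun x => ENNReal.ofReal (mvnPdf S x))) :
    IsProbabilityMeasure ν ∧ (∀ i, MemLp (fun x : Fin d → ℝ => x i) 2 ν) ∧
    (∀ i, ∫ x, x i ∂ν = 0) ∧ ∀ i j, ∫ x, x i * x j ∂ν = S i j := by
  obtain ⟨A, rfl, hA⟩ := exists_root hS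
  rw [mvn_law hA] at hν
  subst hν
  have hm : Measurable (fun x : Fin d → ℝ => A *ᵥ x) :=
    (Continuous.matrix_mulVec continuous_const continuous_id).measurable
  have hI : ∀ i, Integrable (fun x : Fin d → ℝ => x i) (Measure.pi (fun _ : Fin d => gaussianReal 0 1)) :=
    fun i => (gauss_memLp i).integrable (by norm_num)
  have hI2 : ∀ i j, Integrable (fun x : Fin d → ℝ => x i * x j) (Measure.pi (fun _ : Fin d => gaussianReal 0 1)) :=
    fun i j => (gauss_memLp i).integrable_mul (gauss_memLp j)
  refine ⟨Measure.isProbabilityMeasure_map hm.aemeasurable, fun i => ?_, fun i => ?_, fun i j => ?_⟩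
  · rw [memLp_map_measure_iff (measurable_pi_apply i).aestronglyMeasurable hm.aemeasurable]
    simp only [Function.comp_def, mulVec, dotProduct]
    exact memLp_finsetSum _ fun k _ => (gauss_memLp k).const_mul _
  · rw [integral_map hm.aemeasurable (measurable_pi_apply i).aestronglyMeasurable]
    simp only [mulVec, dotProduct]
    rw [integral_finsetSum _ fun k _ => (hI k).const_mul _]
    refine Finset.sum_eq_zero fun k _ => ?_
    rw [integral_const_mul, integral_comp_eval (μ := fun _ : Fin d => gaussianReal 0 1) (i := k)
      (f := fun t : ℝ => t) (by fun_prop)]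
    simp
  · rw [integral_map hm.aemeasurable (by fun_prop)]
    have : ∀ x : Fin d → ℝ, (A *ᵥ x) i * (A *ᵥ x) j = ∑ k, ∑ l, A i k * A j l * (x k * x l) := by
      intro x
      simp only [mulVec, dotProduct, Finset.sum_mul_sum]
      refine Finset.sum_congr rfl fun k _ => Finset.sum_congr rfl fun l _ => by ring
    simp_rw [this]
    rw [integral_finsetSum _ fun k _ => integrable_finsetSum _ fun l _ => (hI2 k l).const_mul _]
    simp_rw [integral_finsetSum _ fun l _ => (hI2 _ l).const_mul _, integral_const_mul, gauss_coord]
    simp [Matrix.mul_apply]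

lemma nPdf_pos (x : ℝ) : 0 < nPdf x := by unfold nPdf; positivity

lemma nPdf_cont : Continuous nPdf := by unfold nPdf; fun_prop

lemma nPdf_pow_int (n : ℕ) : Integrable (fun t => nPdf t * t ^ n) := by
  have := (integrable_rpow_mul_exp_neg_mul_sq (b := 1/2) (by norm_num) (s := n)
    (by have : (0:ℝ) ≤ n := by positivity
        linarith)).const_mul (Real.sqrt (2*π))⁻¹
  refine this.congr (Eventually.of_forall fun t => ?_)
  simp only [Real.rpow_natCast, nPdf]
  rw [show -(t^2)/2 = -(1/2) * t^2 by ring]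
  ring

lemma nPdf_int : Integrable nPdf := by simpa using nPdf_pow_int 0
lemma nPdf_int1 : Integrable (fun t => nPdf t * t) := by simpa using nPdf_pow_int 1

lemma nPdf_neg (x : ℝ) : nPdf (-x) = nPdf x := by simp [nPdf]

lemma nCdf_eq (ε : ℝ) : nCdf ε = ∫ t in Ioi (-ε), nPdf t := by
  rw [← integral_comp_neg_Iic, integral_Iic_eq_integral_Iio]
  simp [nPdf_neg, nCdf]

lemma nCdf_pos (ε : ℝ) : 0 < nCdf ε := by
  unfold nCdf
  rw [setIntegral_pos_iff_support_of_nonneg_ae (Eventually.of_forall fun x => (nPdf_pos x).le)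
    nPdf_int.integrableOn]
  have : Function.support nPdf = univ := by ext x; simp [(nPdf_pos x).ne']
  simp [this]

lemma nPdf_deriv (x : ℝ) : HasDerivAt nPdf (-(nPdf x * x)) x := by
  unfold nPdf
  have := (((hasDerivAt_pow 2 x).fun_neg.div_const 2).exp).const_mul (Real.sqrt (2*π))⁻¹
  refine this.congr_deriv ?_
  simp only [Nat.cast_ofNat]
  ring

lemma mom1 (a : ℝ) : ∫ t in Ioi a, nPdf t * t = nPdf a := by
  have ht : Tendsto nPdf atTop (𝓝 0) :=
    tendsto_zero_of_hasDerivAt_of_integrableOn_Ioi (a := a) (fun x _ => nPdf_deriv x)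
      nPdf_int1.neg.integrableOn nPdf_int.integrableOn
  have := integral_Ioi_of_hasDerivAt_of_tendsto' (a := a) (fun x _ => nPdf_deriv x)
      nPdf_int1.neg.integrableOn ht
  rw [integral_neg] at this
  linarith

lemma mom2 (a : ℝ) : ∫ t in Ioi a, nPdf t * t ^ 2 = a * nPdf a + ∫ t in Ioi a, nPdf t := by
  have hd : ∀ x, HasDerivAt (fun t => nPdf t * t) (nPdf x - nPdf x * x ^ 2) x := by
    intro x
    refine ((nPdf_deriv x).fun_mul (hasDerivAt_id' x)).congr_deriv ?_
    ring
  have hi := nPdf_int.sub (nPdf_pow_int 2)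
  have ht := tendsto_zero_of_hasDerivAt_of_integrableOn_Ioi (a := a) (fun x _ => hd x)
      hi.integrableOn nPdf_int1.integrableOn
  have := integral_Ioi_of_hasDerivAt_of_tendsto' (a := a) (fun x _ => hd x)
      hi.integrableOn ht
  rw [integral_sub nPdf_int.integrableOn (nPdf_pow_int 2).integrableOn] at this
  linarith

lemma trunc_meas (ε : ℝ) : Measurable fun t : ℝ => if -ε < t then nPdf t / nCdf ε else 0 :=
  Measurable.ite measurableSet_Ioi (nPdf_cont.measurable.div_const _) measurable_const

lemma trunc_nonneg (ε t : ℝ) : 0 ≤ if -ε < t then nPdf t / nCdf ε else 0 := by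
  have := nCdf_pos ε
  have := nPdf_pos t
  split_ifs <;> positivity

lemma trunc_moments (ε : ℝ) (ν : Measure ℝ)
    (hν : ν = volume.withDensity (fun t => ENNReal.ofReal (if -ε < t then nPdf t / nCdf ε else 0))) :
    IsProbabilityMeasure ν ∧ MemLp (fun t : ℝ => t) 2 ν ∧
    (∫ t, t ∂ν = nPdf ε / nCdf ε) ∧ ∫ t, t * t ∂ν = 1 - ε * (nPdf ε / nCdf ε) := by
  have hp := nCdf_pos ε
  have hm : Measurable (fun t => ENNReal.ofReal (if -ε < t then nPdf t / nCdf ε else 0)) :=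
    (trunc_meas ε).ennreal_ofReal
  have hr : ∀ n : ℕ, ∀ t, (ENNReal.ofReal (if -ε < t then nPdf t / nCdf ε else 0)).toReal • t ^ n
      = (Ioi (-ε)).indicator (fun t => (nPdf t * t ^ n) / nCdf ε) t := by
    intro n t
    rw [ENNReal.toReal_ofReal (trunc_nonneg ε t)]
    by_cases h : -ε < t
    · simp [h]; ring
    · simp [h]
  have hint : ∀ n : ℕ, Integrable (fun t => t ^ n) ν := by
    intro n
    rw [hν, integrable_withDensity_iff_integrable_smul₀' hm.aemeasurable (by simp)]
    simp_rw [hr]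
    exact ((nPdf_pow_int n).div_const _).indicator measurableSet_Ioi
  have hval : ∀ n : ℕ, ∫ t, t ^ n ∂ν = (∫ t in Ioi (-ε), nPdf t * t ^ n) / nCdf ε := by
    intro n
    rw [hν, integral_withDensity_eq_integral_toReal_smul hm (by simp)]
    simp_rw [hr]
    rw [integral_indicator measurableSet_Ioi, integral_div]
  have h0 := hval 0
  have h1 := hval 1
  have h2 := hval 2
  simp only [pow_zero, pow_one, mul_one] at h0 h1
  rw [← nCdf_eq, div_self hp.ne'] at h0
  rw [mom1, nPdf_neg] at h1
  rw [mom2, nPdf_neg, ← nCdf_eq] at h2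
  refine ⟨⟨?_⟩, ?_, h1, ?_⟩
  · have hf : IsFiniteMeasure ν := by
      have := hint 0
      simpa [integrable_const_iff] using this
    rw [integral_const] at h0
    simp [Measure.real] at h0
    rw [← ENNReal.toReal_eq_one_iff]; exact h0
  · rw [memLp_two_iff_integrable_sq (by fun_prop)]
    exact hint 2
  · simp_rw [← pow_two]
    rw [h2]
    field_simp
    ring

lemma cov_aux (d : ℕ) (Sb : Matrix (Fin d) (Fin d) ℝ) (hpd : Sb.PosDef) (ε : ℝ)
    (μ : Measure ((Fin d → ℝ) × ℝ))
    (hμ : μ = volume.withDensity fun p => ENNReal.ofReal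
      (mvnPdf Sb p.1 * if -ε < p.2 then nPdf p.2 / nCdf ε else 0)) (i j : Fin d) (a b a' b' h : ℝ)
      (hh : h = nPdf ε / nCdf ε) :
    (∫ p, (a * p.1 i + b * p.2) ∂μ = b * h) ∧
    (∫ p, (a * p.1 i + b * p.2 - b * h) * (a' * p.1 j + b' * p.2 - b' * h) ∂μ =
      a * a' * Sb i j + b * b' * (1 - h * (ε + h))) := by
  obtain ⟨hP1, hL1, hE1, hV1⟩ := mvn_moments hpd _ rfl
  obtain ⟨hP2, hL2, hE2, hV2⟩ := trunc_moments ε _ rfl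
  rw [← hh] at hE2 hV2
  set ν1 := (volume : Measure (Fin d → ℝ)).withDensity (fun x => ENNReal.ofReal (mvnPdf Sb x)) with hν1
  set ν2 := (volume : Measure ℝ).withDensity
    (fun t => ENNReal.ofReal (if -ε < t then nPdf t / nCdf ε else 0)) with hν2
  have hprod : μ = ν1.prod ν2 := by
    rw [hμ, hν1, hν2, prod_withDensity (mvnPdf_cont Sb).measurable.ennreal_ofReal
      (trunc_meas ε).ennreal_ofReal]
    congr 1
    ext p
    rw [ENNReal.ofReal_mul (mvnPdf_nonneg hpd _)]
  rw [hprod]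
  have i1 : ∀ i, Integrable (fun p : (Fin d → ℝ) × ℝ => p.1 i) (ν1.prod ν2) := fun i => by
    simpa using ((hL1 i).integrable (by norm_num)).mul_prod (integrable_const (μ := ν2) (1:ℝ))
  have i2 : Integrable (fun p : (Fin d → ℝ) × ℝ => p.2) (ν1.prod ν2) := by
    simpa using (integrable_const (μ := ν1) (1:ℝ)).mul_prod (hL2.integrable (by norm_num))
  have i11 : Integrable (fun p : (Fin d → ℝ) × ℝ => p.1 i * p.1 j) (ν1.prod ν2) := by
    simpa using ((hL1 i).integrable_mul (hL1 j)).mul_prod (integrable_const (μ := ν2) (1:ℝ))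
  have i22 : Integrable (fun p : (Fin d → ℝ) × ℝ => p.2 * p.2) (ν1.prod ν2) := by
    simpa using (integrable_const (μ := ν1) (1:ℝ)).mul_prod (hL2.integrable_mul hL2)
  have i12 : ∀ i, Integrable (fun p : (Fin d → ℝ) × ℝ => p.1 i * p.2) (ν1.prod ν2) := fun i =>
    ((hL1 i).integrable (by norm_num)).mul_prod (hL2.integrable (by norm_num))
  have e1 : ∀ i, ∫ p, p.1 i ∂(ν1.prod ν2) = 0 := fun i => by
    have := integral_prod_mul (μ := ν1) (ν := ν2) (fun x => x i) (fun _ => (1:ℝ))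
    simpa [hE1] using this
  have e2 : ∫ p, p.2 ∂(ν1.prod ν2) = h := by
    have := integral_prod_mul (μ := ν1) (ν := ν2) (fun _ => (1:ℝ)) (fun t => t)
    simpa [hE2] using this
  have e11 : ∫ p, p.1 i * p.1 j ∂(ν1.prod ν2) = Sb i j := by
    have := integral_prod_mul (μ := ν1) (ν := ν2) (fun x => x i * x j) (fun _ => (1:ℝ))
    simpa [hV1] using this
  have e22 : ∫ p, p.2 * p.2 ∂(ν1.prod ν2) = 1 - ε * h := by
    have := integral_prod_mul (μ := ν1) (ν := ν2) (fun _ => (1:ℝ)) (fun t => t * t)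
    simpa [hV2] using this
  have e12 : ∀ i, ∫ p, p.1 i * p.2 ∂(ν1.prod ν2) = 0 := fun i => by
    have := integral_prod_mul (μ := ν1) (ν := ν2) (fun x => x i) (fun t => t)
    simpa [hE1] using this
  constructor
  · rw [integral_add ((i1 i).const_mul _) (i2.const_mul _), integral_const_mul, integral_const_mul,
      e1, e2]
    ring
  · have hx : ∀ p : (Fin d → ℝ) × ℝ,
        (a * p.1 i + b * p.2 - b * h) * (a' * p.1 j + b' * p.2 - b' * h) =
        (a * a') * (p.1 i * p.1 j) + ((a * b') * (p.1 i * p.2) + ((a' * b) * (p.1 j * p.2) +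
        ((b * b') * (p.2 * p.2) + ((-(a * b' * h)) * p.1 i + ((-(a' * b * h)) * p.1 j +
        ((-(2 * b * b' * h)) * p.2 + b * b' * h ^ 2)))))) := fun p => by ring
    simp_rw [hx]
    have j7 := integrable_const (μ := ν1.prod ν2) (b * b' * h ^ 2)
    have j6 := (i2.const_mul (-(2 * b * b' * h))).fun_add j7
    have j5 := ((i1 j).const_mul (-(a' * b * h))).fun_add j6
    have j4 := ((i1 i).const_mul (-(a * b' * h))).fun_add j5
    have j3 := (i22.const_mul (b * b')).fun_add j4
    have j2 := ((i12 j).const_mul (a' * b)).fun_add j3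
    have j1 := ((i12 i).const_mul (a * b')).fun_add j2
    rw [integral_add (i11.const_mul _) j1, integral_add ((i12 i).const_mul _) j2,
      integral_add ((i12 j).const_mul _) j3, integral_add (i22.const_mul _) j4,
      integral_add ((i1 i).const_mul _) j5, integral_add ((i1 j).const_mul _) j6,
      integral_add (i2.const_mul _) j7]
    simp only [integral_const_mul, e1, e2, e11, e22, e12, integral_const, probReal_univ, one_smul]
    ring

/-- mean and covariance of the skew-normal vector built from the
additive-type stochastic representation. -/
theorem skewNormal_additive_moments
    (d : ℕ) (Sb : Matrix (Fin d) (Fin d) ℝ) (hpd : Sb.PosDef)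
    (hSdiag : ∀ i, Sb i i = 1) (ε : ℝ) (δ : Fin d → ℝ)
    (hδ : ∀ i, δ i ∈ Set.Ioo (-1 : ℝ) 1)
    (μ : Measure ((Fin d → ℝ) × ℝ))
    (hμ : μ = volume.withDensity fun p => ENNReal.ofReal
      (mvnPdf Sb p.1 * if -ε < p.2 then nPdf p.2 / nCdf ε else 0)) :
    let T : (Fin d → ℝ) × ℝ → (Fin d → ℝ) := fun p i =>
      Real.sqrt (1 - δ i ^ 2) * p.1 i + δ i * p.2
    let m : Fin d → ℝ := fun i => δ i * nPdf ε / nCdf ε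
    let r : ℝ := nPdf ε / nCdf ε * (ε + nPdf ε / nCdf ε)
    (∀ i, (∫ p, T p i ∂μ) = m i) ∧
    (∀ i j, (∫ p, (T p i - m i) * (T p j - m j) ∂μ) =
      Sb i j * Real.sqrt ((1 - δ i ^ 2) * (1 - δ j ^ 2)) + δ i * δ j * (1 - r)) ∧
    (∀ i, (∫ p, (T p i - m i) ^ 2 ∂μ) = 1 - δ i ^ 2 * r) := by
  intro T m r
  have hm : ∀ i, m i = δ i * (nPdf ε / nCdf ε) := fun i => by simp only [m]; ring
  have hC : ∀ i j, (∫ p, (T p i - m i) * (T p j - m j) ∂μ) =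
      Sb i j * Real.sqrt ((1 - δ i ^ 2) * (1 - δ j ^ 2)) + δ i * δ j * (1 - r) := by
    intro i j
    have hi : 0 ≤ 1 - δ i ^ 2 := by
      have := hδ i
      nlinarith [this.1, this.2]
    rw [hm, hm, Real.sqrt_mul hi]
    refine ((cov_aux d Sb hpd ε μ hμ i j _ _ _ _ _ rfl).2).trans ?_
    simp only [r]
    ring
  refine ⟨fun i => ?_, hC, fun i => ?_⟩
  · rw [hm]
    exact (cov_aux d Sb hpd ε μ hμ i i _ _ 0 0 _ rfl).1
  · have hi : 0 ≤ 1 - δ i ^ 2 := by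
      have := hδ i
      nlinarith [this.1, this.2]
    simp_rw [pow_two (T _ i - m i)]
    rw [hC, hSdiag, Real.sqrt_mul_self hi]
    ring
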